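/- The canonical height H^{can}_{(𝐚,𝐦)}(x,y) = ∏_{i=1}^n r_{m_i}(|ℓ_i(x,y)|)^{1/m_i} · max(|x|,|y|)^{−δ(𝐦)}, defined on coprime integer pairs (x,y) with ℓ_i(x,y) ≠ 0 for all i, has the Northcott property if and only if δ(𝐦) < 0. -/

import Mathlib

open Finset

/-- `phiM m k` is the smallest positive integer `d` such that `k * d` is a perfect
`m`-th power. -/
noncomputable def phiM (m k : ℕ) : ℕ :=
  sInf {d : ℕ | 0 < d ∧ ∃ t : ℕ, k * d = t ^ m}

/-- The linear form `ℓ(x,y) = α·y − β·x` attached to the point `[α : β]` of `ℙ¹`. -/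
def ell (α β x y : ℤ) : ℤ := α * y - β * x

/-- The Euler characteristic `δ(𝐦) = 2 − ∑ᵢ (1 − 1/mᵢ)` of the stacky curve
`𝔛(ℙ¹ : (𝐚, 𝐦))`. -/
noncomputable def deltaM {n : ℕ} (m : Fin n → ℕ) : ℝ :=
  2 - ∑ i, (1 - (m i : ℝ)⁻¹)

/-- The height `H^δ_{(𝐚,𝐦)}(x,y) = ∏ᵢ φ_{mᵢ}(|ℓᵢ(x,y)|)^{1/mᵢ} · max(|x|,|y|)^δ`. -/
noncomputable def stackyHeight {n : ℕ} (α β : Fin n → ℤ) (m : Fin n → ℕ) (δ : ℝ)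
    (x y : ℤ) : ℝ :=
  (∏ i, (phiM (m i) ((ell (α i) (β i) x y).natAbs) : ℝ) ^ ((m i : ℝ)⁻¹)) *
    ((max |x| |y| : ℤ) : ℝ) ^ δ

/-- A height function `H` on the stacky curve has the Northcott property if for every
real `T` there are only finitely many coprime pairs `(x,y)` (finiteness of the set of
pairs is equivalent to finiteness up to simultaneous sign change) with `ℓᵢ(x,y) ≠ 0`
for all `i` and `H(x,y) ≤ T`. -/
def HasNorthcott {n : ℕ} (α β : Fin n → ℤ) (H : ℤ → ℤ → ℝ) : Prop :=
  ∀ T : ℝ, {p : ℤ × ℤ | IsCoprime p.1 p.2 ∧ (∀ i, ell (α i) (β i) p.1 p.2 ≠ 0) ∧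
    H p.1 p.2 ≤ T}.Finite

/-- `rM m k = ∏_p p^{e_p mod m}`, where `k = ∏_p p^{e_p}`. -/
noncomputable def rM (m k : ℕ) : ℕ :=
  k.factorization.prod fun p e => p ^ (e % m)

/-- The canonical height
`H^{can}_{(𝐚,𝐦)}(x,y) = ∏ᵢ r_{mᵢ}(|ℓᵢ(x,y)|)^{1/mᵢ} · max(|x|,|y|)^{−δ(𝐦)}`. -/
noncomputable def canonicalHeight {n : ℕ} (α β : Fin n → ℤ) (m : Fin n → ℕ)
    (x y : ℤ) : ℝ :=
  (∏ i, (rM (m i) ((ell (α i) (β i) x y).natAbs) : ℝ) ^ ((m i : ℝ)⁻¹)) *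
    ((max |x| |y| : ℤ) : ℝ) ^ (-(deltaM m))

/-! ### The function `rM` -/

theorem factorization_rM (m k p : ℕ) :
    (rM m k).factorization p = k.factorization p % m := by
  have h : rM m k = (k.factorization.mapRange (· % m) (Nat.zero_mod m)).prod (· ^ ·) := by
    rw [rM, Finsupp.prod_mapRange_index (by simp)]
  rw [h, Nat.prod_pow_factorization_eq_self, Finsupp.mapRange_apply]
  intro q hq
  exact Nat.prime_of_mem_primeFactors
    (Nat.support_factorization k ▸ Finsupp.support_mapRange hq)

theorem rM_pos (m k : ℕ) : 0 < rM m k := by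
  rw [rM, Finsupp.prod]
  refine Nat.pos_of_ne_zero (Finset.prod_ne_zero_iff.2 fun p hp => pow_ne_zero _ ?_)
  exact (Nat.prime_of_mem_primeFactors (Nat.support_factorization k ▸ hp)).ne_zero

theorem rM_le {m k : ℕ} (hk : k ≠ 0) : rM m k ≤ k := by
  refine Nat.le_of_dvd (Nat.pos_of_ne_zero hk)
    ((Nat.factorization_le_iff_dvd (rM_pos m k).ne' hk).1 fun p => ?_)
  rw [factorization_rM]
  exact Nat.mod_le _ _

theorem mul_mod_add_mul_le {m M v : ℕ} (hm : 0 < m) (hmM : m ≤ M) (hv : M ∣ v) :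
    M * (v % m) + m * v ≤ M * v := by
  obtain ⟨q, rfl⟩ := hv
  have hq : q ≤ M * q / m := by
    rw [Nat.le_div_iff_mul_le hm, mul_comm]
    exact Nat.mul_le_mul_right _ hmM
  have h := Nat.mod_add_div (M * q) m
  have h' : m * (M * q) ≤ M * (m * (M * q / m)) := by
    calc m * (M * q) = M * (m * q) := by ring
      _ ≤ _ := by gcongr
  calc _ ≤ M * (M * q % m) + M * (m * (M * q / m)) := by gcongr
    _ = M * (M * q % m + m * (M * q / m)) := by ring
    _ = _ := by rw [h]

/-- `IsPowOff N M a` says that, up to primes dividing `N`, the integer `a` is an `M`-th power. -/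
def IsPowOff (N : ℤ) (M : ℕ) (a : ℤ) : Prop :=
  ∀ p : ℕ, p.Prime → ¬(p : ℤ) ∣ N → M ∣ a.natAbs.factorization p

/-- `CoprimeOff N a b` says that every common prime divisor of `a` and `b` divides `N`. -/
def CoprimeOff (N a b : ℤ) : Prop :=
  ∀ p : ℕ, p.Prime → (p : ℤ) ∣ a → (p : ℤ) ∣ b → (p : ℤ) ∣ N

theorem rM_pow_mul_pow_le {m M : ℕ} {N a : ℤ} (hm : 0 < m) (hmM : m ≤ M) (ha : a ≠ 0)
    (hN : N ≠ 0) (h : IsPowOff N M a) :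
    rM m a.natAbs ^ M * a.natAbs ^ m ≤ a.natAbs ^ M * N.natAbs ^ (M * m) := by
  have hk : a.natAbs ≠ 0 := by simpa
  have hN' : N.natAbs ≠ 0 := by simpa
  have hr := (rM_pos m a.natAbs).ne'
  refine Nat.le_of_dvd (by positivity) ((Nat.factorization_prime_le_iff_dvd
    (by positivity) (by positivity)).1 fun p hp => ?_)
  rw [Nat.factorization_mul (by positivity) (by positivity),
    Nat.factorization_mul (by positivity) (by positivity)]
  simp only [Nat.factorization_pow, Finsupp.add_apply, Finsupp.smul_apply, smul_eq_mul,
    factorization_rM]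
  by_cases hpN : (p : ℤ) ∣ N
  · have h1 : 1 ≤ N.natAbs.factorization p :=
      (hp.dvd_iff_one_le_factorization hN').1 (Int.natCast_dvd.1 hpN)
    have h2 : M * (a.natAbs.factorization p % m) ≤ M * m * N.natAbs.factorization p :=
      calc _ ≤ M * m := Nat.mul_le_mul_left _ (Nat.mod_lt _ hm).le
        _ ≤ _ := Nat.le_mul_of_pos_right _ h1
    have h3 := Nat.mul_le_mul_right (a.natAbs.factorization p) hmM
    omega
  · exact (mul_mod_add_mul_le hm hmM (h p hp hpN)).trans (Nat.le_add_right _ _)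

theorem rM_rpow_le {m M : ℕ} {N a : ℤ} (hm : 0 < m) (ha : a ≠ 0) (hN : N ≠ 0)
    (h : M = 0 ∨ m ≤ M ∧ IsPowOff N M a) :
    (rM m a.natAbs : ℝ) ^ (m : ℝ)⁻¹ ≤
      (N.natAbs : ℝ) * (a.natAbs : ℝ) ^ ((m : ℝ)⁻¹ - (M : ℝ)⁻¹) := by
  have hN1 : (1 : ℝ) ≤ N.natAbs := by exact_mod_cast Int.natAbs_pos.2 hN
  have ha1 : (0 : ℝ) < a.natAbs := by exact_mod_cast Int.natAbs_pos.2 ha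
  have hr := rM_pos m a.natAbs
  rcases h with rfl | ⟨hmM, hp⟩
  · simp only [Nat.cast_zero, inv_zero, sub_zero]
    calc (rM m a.natAbs : ℝ) ^ (m : ℝ)⁻¹ ≤ (a.natAbs : ℝ) ^ (m : ℝ)⁻¹ := by
          gcongr
          exact rM_le (by simpa)
      _ ≤ _ := le_mul_of_one_le_left (by positivity) hN1
  · have hM : 0 < M := hm.trans_le hmM
    have hmR : (m : ℝ) ≠ 0 := by positivity
    have hMR : (M : ℝ) ≠ 0 := by positivity
    have key : (rM m a.natAbs : ℝ) ^ M * (a.natAbs : ℝ) ^ m ≤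
        (a.natAbs : ℝ) ^ M * (N.natAbs : ℝ) ^ (M * m) := by
      exact_mod_cast rM_pow_mul_pow_le hm hmM ha hN hp
    have key' := Real.rpow_le_rpow (z := ((M : ℝ) * m)⁻¹) (by positivity) key (by positivity)
    rw [Real.mul_rpow (by positivity) (by positivity),
      Real.mul_rpow (by positivity) (by positivity)] at key'
    simp only [← Real.rpow_natCast] at key'
    rw [← Real.rpow_mul (by positivity), ← Real.rpow_mul (by positivity),
      ← Real.rpow_mul (by positivity), ← Real.rpow_mul (by positivity)] at key'
    have e1 : (M : ℝ) * ((M : ℝ) * m)⁻¹ = (m : ℝ)⁻¹ := by field_simp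
    have e2 : (m : ℝ) * ((M : ℝ) * m)⁻¹ = (M : ℝ)⁻¹ := by field_simp
    have e3 : ((M * m : ℕ) : ℝ) * ((M : ℝ) * m)⁻¹ = 1 := by
      push_cast
      field_simp
    rw [e1, e2, e3, Real.rpow_one] at key'
    rw [Real.rpow_sub ha1, ← mul_div_assoc, le_div_iff₀ (by positivity)]
    linarith

/-! ### Integers that are powers away from a given integer -/

namespace IsPowOff

variable {N N' a b : ℤ} {M : ℕ}

theorem mul (ha : a ≠ 0) (hb : b ≠ 0) (h : IsPowOff N M a) (h' : IsPowOff N M b) :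
    IsPowOff N M (a * b) := fun p hp hpN => by
  rw [Int.natAbs_mul, Nat.factorization_mul (by simpa) (by simpa)]
  exact dvd_add (h p hp hpN) (h' p hp hpN)

theorem pow (h : IsPowOff N M a) (k : ℕ) : IsPowOff N (k * M) (a ^ k) := fun p hp hpN => by
  rw [Int.natAbs_pow, Nat.factorization_pow]
  exact mul_dvd_mul_left _ (h p hp hpN)

theorem one (N a : ℤ) : IsPowOff N 1 a := fun _ _ _ => one_dvd _

theorem pow_self (N a : ℤ) (M : ℕ) : IsPowOff N M (a ^ M) := by
  simpa using (one N a).pow M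

theorem of_dvd (h : a ∣ N) : IsPowOff N M a := fun p _ hpN => by
  rw [Nat.factorization_eq_zero_of_not_dvd
    fun hpa => hpN ((Int.natCast_dvd.2 hpa).trans h)]
  exact dvd_zero M

theorem mono (hN : N ∣ N') (h : IsPowOff N M a) : IsPowOff N' M a :=
  fun p hp hpN => h p hp fun h' => hpN (h'.trans hN)

theorem neg (h : IsPowOff N M a) : IsPowOff N M (-a) := fun p hp hpN => by
  rw [Int.natAbs_neg]
  exact h p hp hpN

theorem of_mul_left (ha : a ≠ 0) (hb : b ≠ 0) (h : IsPowOff N M (a * b))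
    (ha' : ∀ p : ℕ, p.Prime → (p : ℤ) ∣ a → (p : ℤ) ∣ N) : IsPowOff N M b := fun p hp hpN => by
  have := h p hp hpN
  rw [Int.natAbs_mul, Nat.factorization_mul (by simpa) (by simpa), Finsupp.add_apply,
    Nat.factorization_eq_zero_of_not_dvd
      fun hpa => hpN (ha' p hp (Int.natCast_dvd.2 hpa)), zero_add] at this
  exact this

end IsPowOff

/-! ### Bounding the canonical height -/

theorem one_le_max_abs {x y : ℤ} (h : IsCoprime x y) : 1 ≤ max |x| |y| := by
  by_contra! hlt
  have hx : x = 0 := abs_nonpos_iff.1 ((le_max_left _ _).trans (Int.lt_add_one_iff.1 hlt))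
  have hy : y = 0 := abs_nonpos_iff.1 ((le_max_right _ _).trans (Int.lt_add_one_iff.1 hlt))
  subst hx hy
  exact not_isCoprime_zero_zero h

theorem natAbs_ell_le (α β x y : ℤ) :
    ((ell α β x y).natAbs : ℝ) ≤ ((|α| + |β| : ℤ) : ℝ) * ((max |x| |y| : ℤ) : ℝ) := by
  rw [← Int.cast_mul, Nat.cast_natAbs, Int.cast_le, ell]
  have hx := mul_le_mul_of_nonneg_left (le_max_left |x| |y|) (abs_nonneg β)
  have hy := mul_le_mul_of_nonneg_left (le_max_right |x| |y|) (abs_nonneg α)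
  have h := abs_sub (α * y) (β * x)
  rw [abs_mul, abs_mul] at h
  linarith

theorem canonicalHeight_le {n : ℕ} {α β : Fin n → ℤ} {m M : Fin n → ℕ} {N x y : ℤ}
    (hm : ∀ i, 0 < m i) (hM : (n : ℝ) - 2 ≤ ∑ i, (M i : ℝ)⁻¹) (hN : N ≠ 0)
    (hxy : IsCoprime x y) (hne : ∀ i, ell (α i) (β i) x y ≠ 0)
    (h : ∀ i, M i = 0 ∨ m i ≤ M i ∧ IsPowOff N (M i) (ell (α i) (β i) x y)) :
    canonicalHeight α β m x y ≤
      ∏ i, ((N.natAbs : ℝ) * ((|α i| + |β i| : ℤ) : ℝ) ^ ((m i : ℝ)⁻¹ - (M i : ℝ)⁻¹)) := by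
  set X : ℝ := ((max |x| |y| : ℤ) : ℝ) with hX
  have hX1 : 1 ≤ X := by
    rw [hX]
    exact_mod_cast one_le_max_abs hxy
  have hX0 : 0 < X := by linarith
  have hterm : ∀ i, (rM (m i) (ell (α i) (β i) x y).natAbs : ℝ) ^ (m i : ℝ)⁻¹ ≤
      ((N.natAbs : ℝ) * ((|α i| + |β i| : ℤ) : ℝ) ^ ((m i : ℝ)⁻¹ - (M i : ℝ)⁻¹)) *
        X ^ ((m i : ℝ)⁻¹ - (M i : ℝ)⁻¹) := fun i => by
    have he : 0 ≤ (m i : ℝ)⁻¹ - (M i : ℝ)⁻¹ := by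
      rcases h i with h0 | ⟨hle, -⟩
      · simp [h0]
      · have := hm i
        rw [sub_nonneg]
        gcongr
    refine (rM_rpow_le (hm i) (hne i) hN (h i)).trans ?_
    rw [mul_assoc, ← Real.mul_rpow (by positivity) hX0.le]
    gcongr
    exact natAbs_ell_le _ _ _ _
  have hexp : ∑ i, ((m i : ℝ)⁻¹ - (M i : ℝ)⁻¹) + -deltaM m ≤ 0 := by
    simp only [deltaM, Finset.sum_sub_distrib, Finset.sum_const, Finset.card_univ,
      Fintype.card_fin, nsmul_eq_mul, mul_one]
    linarith
  calc canonicalHeight α β m x y ≤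
      (∏ i, (((N.natAbs : ℝ) * ((|α i| + |β i| : ℤ) : ℝ) ^ ((m i : ℝ)⁻¹ - (M i : ℝ)⁻¹)) *
        X ^ ((m i : ℝ)⁻¹ - (M i : ℝ)⁻¹))) * X ^ (-deltaM m) := by
        rw [canonicalHeight]
        gcongr with i
        exact hterm i
    _ = (∏ i, ((N.natAbs : ℝ) * ((|α i| + |β i| : ℤ) : ℝ) ^ ((m i : ℝ)⁻¹ - (M i : ℝ)⁻¹))) *
        X ^ (∑ i, ((m i : ℝ)⁻¹ - (M i : ℝ)⁻¹) + -deltaM m) := by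
        rw [Finset.prod_mul_distrib, ← Real.rpow_sum_of_pos hX0, mul_assoc,
          ← Real.rpow_add hX0]
    _ ≤ _ := mul_le_of_le_one_right (Finset.prod_nonneg fun i _ => by positivity)
        (Real.rpow_le_one_of_one_le_of_nonpos hX1 hexp)

theorem not_hasNorthcott_of_family {n : ℕ} {α β : Fin n → ℤ} {m M : Fin n → ℕ} {N : ℤ}
    {x y : ℕ → ℤ} (hm : ∀ i, 0 < m i) (hM : (n : ℝ) - 2 ≤ ∑ i, (M i : ℝ)⁻¹) (hN : N ≠ 0)
    (hxy : ∀ k, CoprimeOff N (x k) (y k)) (hne : ∀ k i, ell (α i) (β i) (x k) (y k) ≠ 0)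
    (h : ∀ k i, M i = 0 ∨ m i ≤ M i ∧ IsPowOff N (M i) (ell (α i) (β i) (x k) (y k)))
    (hn : 0 < n) (hinj : ∀ j k, x j * y k = x k * y j → j = k) :
    ¬ HasNorthcott α β (canonicalHeight α β m) := by
  have hred : ∀ k, ∃ g x' y' : ℤ, x k = g * x' ∧ y k = g * y' ∧ IsCoprime x' y' := fun k => by
    have h0 : ¬ (x k = 0 ∧ y k = 0) := fun ⟨hx, hy⟩ =>
      hne k ⟨0, hn⟩ (by simp [hx, hy, ell])
    have hg : 0 < Int.gcd (x k) (y k) := Int.gcd_pos_iff.2 (by tauto)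
    obtain ⟨x', y', hc, hx, hy⟩ := Int.exists_gcd_one hg
    exact ⟨_, x', y', by rw [mul_comm]; exact hx, by rw [mul_comm]; exact hy,
      Int.isCoprime_iff_gcd_eq_one.2 hc⟩
  choose g x' y' hx hy hc using hred
  intro hfin
  refine Set.infinite_range_of_injective (f := fun k => (x' k, y' k)) (fun j k hjk => ?_)
    ((hfin (∏ i, ((N.natAbs : ℝ) *
      ((|α i| + |β i| : ℤ) : ℝ) ^ ((m i : ℝ)⁻¹ - (M i : ℝ)⁻¹)))).subset ?_)
  · simp only [Prod.mk.injEq] at hjk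
    refine hinj j k ?_
    rw [hx, hx, hy, hy, hjk.1, hjk.2]
    ring
  · rintro _ ⟨k, rfl⟩
    have hell : ∀ i, ell (α i) (β i) (x k) (y k) = g k * ell (α i) (β i) (x' k) (y' k) :=
      fun i => by
        rw [hx, hy, ell, ell]
        ring
    have hne' : ∀ i, g k ≠ 0 ∧ ell (α i) (β i) (x' k) (y' k) ≠ 0 := fun i =>
      mul_ne_zero_iff.1 (hell i ▸ hne k i)
    refine ⟨hc k, fun i => (hne' i).2, canonicalHeight_le hm hM hN (hc k)
      (fun i => (hne' i).2) fun i => (h k i).imp_right fun ⟨hle, hp⟩ => ⟨hle, ?_⟩⟩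
    rw [hell] at hp
    exact hp.of_mul_left (hne' i).1 (hne' i).2 fun p hpp hpg =>
      hxy k p hpp (hx k ▸ hpg.mul_right _) (hy k ▸ hpg.mul_right _)

theorem hasNorthcott_of_deltaM_neg {n : ℕ} (α β : Fin n → ℤ) {m : Fin n → ℕ}
    (h : deltaM m < 0) : HasNorthcott α β (canonicalHeight α β m) := by
  intro T
  obtain ⟨B, hB⟩ := Filter.eventually_atTop.1
    ((tendsto_rpow_atTop (neg_pos.2 h)).eventually_gt_atTop T)
  refine ((Set.finite_Icc (-⌈B⌉) ⌈B⌉).prod (Set.finite_Icc (-⌈B⌉) ⌈B⌉)).subset ?_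
  rintro ⟨x, y⟩ ⟨-, -, hT⟩
  have hprod : (1 : ℝ) ≤ ∏ i, (rM (m i) (ell (α i) (β i) x y).natAbs : ℝ) ^ (m i : ℝ)⁻¹ := by
    rw [← Finset.prod_const_one (s := (Finset.univ : Finset (Fin n)))]
    refine Finset.prod_le_prod (fun _ _ => zero_le_one) fun i _ =>
      Real.one_le_rpow ?_ (by positivity)
    exact_mod_cast rM_pos _ _
  have hX : ((max |x| |y| : ℤ) : ℝ) < B := by
    by_contra! hle
    have h1 := hB _ hle
    have h2 : ((max |x| |y| : ℤ) : ℝ) ^ (-deltaM m) ≤ canonicalHeight α β m x y :=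
      le_mul_of_one_le_left (Real.rpow_nonneg (by positivity) _) hprod
    exact absurd (h2.trans hT) (not_le.2 h1)
  have hX' : max |x| |y| ≤ ⌈B⌉ := by exact_mod_cast hX.le.trans (Int.le_ceil B)
  exact ⟨abs_le.1 ((le_max_left _ _).trans hX'), abs_le.1 ((le_max_right _ _).trans hX')⟩

/-! ### Orbits of Lattès-type maps -/

theorem padicValInt_two_lt_mul {t c : ℤ} (h : t * c ≠ 0) (hc : 2 ∣ c) :
    padicValInt 2 t < padicValInt 2 (t * c) := by
  obtain ⟨ht, hc0⟩ := mul_ne_zero_iff.1 h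
  rw [padicValInt.mul ht hc0]
  have : 1 ≤ padicValInt 2 c := by
    have := (padicValInt_dvd_iff (p := 2) 1 c).1 (by simpa using hc)
    tauto
  omega

theorem exists_orbit (P : ℤ → ℤ → Prop) (f g : ℤ → ℤ → ℤ) {s₀ t₀ : ℤ} (h₀ : P s₀ t₀)
    (hodd : ∀ s t, P s t → Odd s) (ht : ∀ s t, P s t → t ≠ 0)
    (hstep : ∀ s t, P s t → P (f s t) (g s t))
    (hval : ∀ s t, P s t → padicValInt 2 t < padicValInt 2 (g s t)) :
    ∃ s t : ℕ → ℤ, (∀ k, P (s k) (t k)) ∧ ∀ j k, s j * t k = s k * t j → j = k := by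
  let F : ℤ × ℤ → ℤ × ℤ := fun q => (f q.1 q.2, g q.1 q.2)
  let q : ℕ → ℤ × ℤ := fun k => F^[k] (s₀, t₀)
  have hq : ∀ k, q (k + 1) = F (q k) := fun k => Function.iterate_succ_apply' _ _ _
  have hP : ∀ k, P (q k).1 (q k).2 := fun k => by
    induction k with
    | zero => exact h₀
    | succ k ih =>
      rw [hq]
      exact hstep _ _ ih
  have hmono : StrictMono fun k => padicValInt 2 (q k).2 := strictMono_nat_of_lt_succ fun k => by
    rw [hq]
    exact hval _ _ (hP k)
  refine ⟨fun k => (q k).1, fun k => (q k).2, hP, fun j k hjk => hmono.injective ?_⟩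
  have hv : ∀ i l, padicValInt 2 ((q i).1 * (q l).2) = padicValInt 2 (q l).2 := fun i l => by
    have hi := hodd _ _ (hP i)
    rw [padicValInt.mul (fun h => by simp [h] at hi) (ht _ _ (hP l)),
      padicValInt.eq_zero_of_not_dvd (by
        rw [← even_iff_two_dvd.trans (by rfl : (2 : ℤ) ∣ (q i).1 ↔ ((2 : ℕ) : ℤ) ∣ (q i).1)]
        exact Int.not_even_iff_odd.2 hi), zero_add]
  have := congrArg (padicValInt 2) hjk
  rw [hv, hv] at this
  exact this.symm

/-- There are infinitely many points `[s : t]` such that `s`, `t` and `s + t` are powers of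
exponents `a`, `b`, `c` away from some fixed integer; an exponent `0` imposes no condition. -/
def HasTriples (a b c : ℕ) : Prop :=
  ∃ N : ℤ, N ≠ 0 ∧ ∃ s t : ℕ → ℤ,
    (∀ k, s k ≠ 0 ∧ t k ≠ 0 ∧ s k + t k ≠ 0 ∧ CoprimeOff N (s k) (t k) ∧
      IsPowOff N a (s k) ∧ IsPowOff N b (t k) ∧ (c = 0 ∨ IsPowOff N c (s k + t k))) ∧
    ∀ j k, s j * t k = s k * t j → j = k

theorem hasTriples_two_two_zero : HasTriples 2 2 0 := by
  refine ⟨1, one_ne_zero, fun k => ((k : ℤ) + 2) ^ 2, fun _ => -1, fun k => ⟨by positivity,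
    by simp, ?_, fun p _ _ hp => by simpa using hp, .pow_self _ _ 2,
    .of_dvd (by simp), Or.inl rfl⟩, fun j k h => ?_⟩
  · have : (0 : ℤ) ≤ k := by positivity
    simp only
    nlinarith
  · have h' : ((j : ℤ) + 2) ^ 2 = ((k : ℤ) + 2) ^ 2 := by linarith
    have := (pow_left_inj₀ (by positivity) (by positivity) two_ne_zero).1 h'
    omega

theorem Odd.ne_zero_int {a : ℤ} (h : Odd a) : a ≠ 0 := by
  rintro rfl
  simp at h

theorem coprimeOff_of_prime {N a b : ℤ}
    (h : ∀ p : ℕ, Prime (p : ℤ) → (p : ℤ) ∣ a → (p : ℤ) ∣ b → (p : ℤ) ∣ N) :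
    CoprimeOff N a b := fun p hp => h p (Nat.prime_iff_prime_int.1 hp)

theorem CoprimeOff.dvd {N a b : ℤ} {p : ℕ} (h : CoprimeOff N a b) (hp : Prime (p : ℤ))
    (ha : (p : ℤ) ∣ a) (hb : (p : ℤ) ∣ b) : (p : ℤ) ∣ N :=
  h p (Nat.prime_iff_prime_int.2 hp) ha hb

theorem hasTriples_of_orbit {a b c : ℕ} (N d : ℤ) (hN : N ≠ 0) (hd : 2 ∣ d) (f g : ℤ → ℤ → ℤ)
    (s₀ t₀ : ℤ)
    (h₀ : Odd s₀ ∧ d ∣ t₀ ∧ t₀ ≠ 0 ∧ CoprimeOff N s₀ t₀ ∧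
      IsPowOff N a s₀ ∧ IsPowOff N b t₀ ∧ IsPowOff N c (s₀ + t₀))
    (hstep : ∀ s t, (Odd s ∧ d ∣ t ∧ t ≠ 0 ∧ CoprimeOff N s t ∧
        IsPowOff N a s ∧ IsPowOff N b t ∧ IsPowOff N c (s + t)) →
      Odd (f s t) ∧ d ∣ g s t ∧ g s t ≠ 0 ∧ CoprimeOff N (f s t) (g s t) ∧
        IsPowOff N a (f s t) ∧ IsPowOff N b (g s t) ∧ IsPowOff N c (f s t + g s t))
    (hval : ∀ s t, Odd s → d ∣ t → t ≠ 0 → padicValInt 2 t < padicValInt 2 (g s t)) :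
    HasTriples a b c := by
  obtain ⟨s, t, h, hinj⟩ := exists_orbit
    (fun s t => Odd s ∧ d ∣ t ∧ t ≠ 0 ∧ CoprimeOff N s t ∧
      IsPowOff N a s ∧ IsPowOff N b t ∧ IsPowOff N c (s + t)) f g h₀
    (fun s t h => h.1) (fun s t h => h.2.2.1) hstep
    (fun s t h => hval s t h.1 h.2.1 h.2.2.1)
  refine ⟨N, hN, s, t, fun k => ?_, hinj⟩
  obtain ⟨hs, hdt, ht, hc, h1, h2, h3⟩ := h k
  have hst : Odd (s k + t k) := hs.add_even (even_iff_two_dvd.2 (hd.trans hdt))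
  exact ⟨hs.ne_zero_int, ht, hst.ne_zero_int, hc, h1, h2, Or.inr h3⟩

theorem hasTriples_three_three_three : HasTriples 3 3 3 := by
  refine hasTriples_of_orbit 6 4 (by decide) (by decide)
    (fun s t => -s * (s + 2 * t) ^ 3) (fun s t => t * (2 * s + t) ^ 3) (-1) 4
    ⟨by decide, by decide, by decide, fun p hp h1 _ => (h1.trans (by decide)),
      .of_dvd (by decide), ?_, .of_dvd (by decide)⟩ ?_ ?_
  · exact ((IsPowOff.of_dvd (by decide : (2 : ℤ) ∣ 6) (M := 3)).mul (by decide) (by decide)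
      (.of_dvd (by decide)) : IsPowOff 6 3 (2 * 2))
  · rintro s t ⟨hs, ht4, ht, hc, h1, h2, h3⟩
    have ht2 : Even t := even_iff_two_dvd.2 (dvd_trans (by decide) ht4)
    have e1 : Odd (s + 2 * t) := hs.add_even (even_two_mul t)
    have e2 : Odd (t - s) := ht2.sub_odd hs
    have e3 : Odd (s + t) := hs.add_even ht2
    have e4 : 2 * s + t ≠ 0 := by
      intro h0
      obtain ⟨u, rfl⟩ := ht4
      obtain ⟨v, rfl⟩ := hs
      omega
    refine ⟨hs.neg.mul e1.pow, ht4.mul_right _, mul_ne_zero ht (pow_ne_zero _ e4),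
      coprimeOff_of_prime fun p hp ha hb => ?_,
      h1.neg.mul (neg_ne_zero.2 hs.ne_zero_int) (pow_ne_zero _ e1.ne_zero_int)
        (.pow_self _ _ 3), h2.mul ht (pow_ne_zero _ e4) (.pow_self _ _ 3), ?_⟩
    · by_cases hps : (p : ℤ) ∣ s
      · refine hc.dvd hp hps ?_
        rcases hp.dvd_or_dvd hb with hb | hb
        · exact hb
        · have := hp.dvd_of_dvd_pow hb
          exact (Int.dvd_add_right (hps.mul_left 2)).1 this
      have ha' : (p : ℤ) ∣ s + 2 * t := by
        rcases hp.dvd_or_dvd ha with ha | ha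
        · exact absurd (Int.dvd_neg.1 ha) hps
        · exact hp.dvd_of_dvd_pow ha
      rcases hp.dvd_or_dvd hb with hb | hb
      · exact absurd ((Int.dvd_add_left (hb.mul_left 2)).1 ha') hps
      · have hb' := hp.dvd_of_dvd_pow hb
        have h3s : (p : ℤ) ∣ 3 * s := by
          have := (hb'.mul_left 2).sub ha'
          ring_nf at this ⊢
          exact this
        exact ((hp.dvd_or_dvd h3s).resolve_right hps).trans (by decide)
    · have : -s * (s + 2 * t) ^ 3 + t * (2 * s + t) ^ 3 = (s + t) * (t - s) ^ 3 := by ring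
      rw [this]
      exact h3.mul e3.ne_zero_int (pow_ne_zero _ e2.ne_zero_int) (.pow_self _ _ 3)
  · intro s t hs ht4 ht
    refine padicValInt_two_lt_mul (mul_ne_zero ht (pow_ne_zero _ ?_)) ?_
    · intro h0
      obtain ⟨u, rfl⟩ := ht4
      obtain ⟨v, rfl⟩ := hs
      omega
    · exact ((dvd_mul_right 2 s).add (dvd_trans (by decide) ht4)).pow three_ne_zero

theorem hasTriples_four_four_two : HasTriples 4 4 2 := by
  refine hasTriples_of_orbit 6 2 (by decide) (by decide)
    (fun s t => (s - t) ^ 4) (fun s t => t * (2 ^ 4 * ((s + t) ^ 2 * s))) 1 2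
    ⟨by decide, by decide, by decide, fun p hp h1 _ => (h1.trans (by decide)),
      .of_dvd (by decide), .of_dvd (by decide), .of_dvd (by decide)⟩ ?_ ?_
  · rintro s t ⟨hs, ht2, ht, hc, h1, h2, h3⟩
    have e1 : Odd (s - t) := hs.sub_even (even_iff_two_dvd.2 ht2)
    have e2 : Odd (s + t) := hs.add_even (even_iff_two_dvd.2 ht2)
    have e3 : (s + t) ^ 2 ≠ 0 := pow_ne_zero _ e2.ne_zero_int
    have e4 : (s + t) ^ 2 * s ≠ 0 := mul_ne_zero e3 hs.ne_zero_int
    have e5 : (2 : ℤ) ^ 4 * ((s + t) ^ 2 * s) ≠ 0 := mul_ne_zero (by decide) e4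
    refine ⟨e1.pow, ht2.mul_right _, mul_ne_zero ht e5,
      coprimeOff_of_prime fun p hp ha hb => ?_, .pow_self _ _ 4,
      h2.mul ht e5 ((IsPowOff.pow_self _ _ 4).mul (by decide) e4
        ((h3.pow 2).mul e3 hs.ne_zero_int h1)), ?_⟩
    · have ha' := hp.dvd_of_dvd_pow ha
      rcases hp.dvd_or_dvd hb with hb | hb
      · exact hc.dvd hp ((_root_.dvd_sub_left hb).1 ha') hb
      rcases hp.dvd_or_dvd hb with hb | hb
      · exact (hp.dvd_of_dvd_pow hb).trans (by decide)
      rcases hp.dvd_or_dvd hb with hb | hb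
      · have hb' := hp.dvd_of_dvd_pow hb
        have h2s : (p : ℤ) ∣ 2 * s := by
          have := hb'.add ha'
          ring_nf at this ⊢
          exact this
        rcases hp.dvd_or_dvd h2s with h | h
        · exact h.trans (by decide)
        · exact hc.dvd hp h ((Int.dvd_add_right h).1 hb')
      · exact hc.dvd hp hb ((_root_.dvd_sub_right hb).1 ha')
    · have : (s - t) ^ 4 + t * (2 ^ 4 * ((s + t) ^ 2 * s)) =
          (s ^ 2 + 6 * s * t + t ^ 2) ^ 2 := by ring
      rw [this]
      exact .pow_self _ _ 2
  · intro s t hs ht2 ht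
    have e2 : Odd (s + t) := hs.add_even (even_iff_two_dvd.2 ht2)
    refine padicValInt_two_lt_mul (mul_ne_zero ht (mul_ne_zero (by decide)
      (mul_ne_zero (pow_ne_zero _ e2.ne_zero_int) hs.ne_zero_int))) (Dvd.dvd.mul_right ?_ _)
    decide

theorem hasTriples_three_six_two : HasTriples 3 6 2 := by
  refine hasTriples_of_orbit 6 2 (by decide) (by decide)
    (fun s t => s * (s - 8 * t) ^ 3) (fun s t => t * (2 ^ 6 * (s + t) ^ 3)) 1 2
    ⟨by decide, by decide, by decide, fun p hp h1 _ => (h1.trans (by decide)),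
      .of_dvd (by decide), .of_dvd (by decide), .of_dvd (by decide)⟩ ?_ ?_
  · rintro s t ⟨hs, ht2, ht, hc, h1, h2, h3⟩
    have e1 : Odd (s - 8 * t) := hs.sub_even ((even_iff_two_dvd.2 ht2).mul_left 8)
    have e2 : Odd (s + t) := hs.add_even (even_iff_two_dvd.2 ht2)
    have e3 : (s + t) ^ 3 ≠ 0 := pow_ne_zero _ e2.ne_zero_int
    have e5 : (2 : ℤ) ^ 6 * (s + t) ^ 3 ≠ 0 := mul_ne_zero (by decide) e3
    refine ⟨hs.mul e1.pow, ht2.mul_right _, mul_ne_zero ht e5,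
      coprimeOff_of_prime fun p hp ha hb => ?_,
      h1.mul hs.ne_zero_int (pow_ne_zero _ e1.ne_zero_int) (.pow_self _ _ 3),
      h2.mul ht e5 ((IsPowOff.pow_self _ _ 6).mul (by decide) e3 (h3.pow 3)), ?_⟩
    · rcases hp.dvd_or_dvd hb with hb | hb
      · refine hc.dvd hp ?_ hb
        rcases hp.dvd_or_dvd ha with ha | ha
        · exact ha
        · exact (_root_.dvd_sub_left (hb.mul_left 8)).1 (hp.dvd_of_dvd_pow ha)
      rcases hp.dvd_or_dvd hb with hb | hb
      · exact (hp.dvd_of_dvd_pow hb).trans (by decide)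
      have hb' := hp.dvd_of_dvd_pow hb
      rcases hp.dvd_or_dvd ha with ha | ha
      · exact hc.dvd hp ha ((Int.dvd_add_right ha).1 hb')
      · have h9t : (p : ℤ) ∣ 3 ^ 2 * t := by
          have := hb'.sub (hp.dvd_of_dvd_pow ha)
          ring_nf at this ⊢
          exact this
        rcases hp.dvd_or_dvd h9t with h | h
        · exact (hp.dvd_of_dvd_pow h).trans (by decide)
        · exact hc.dvd hp ((Int.dvd_add_left h).1 hb') h
    · have : s * (s - 8 * t) ^ 3 + t * (2 ^ 6 * (s + t) ^ 3) =
          (s ^ 2 + 20 * s * t - 8 * t ^ 2) ^ 2 := by ring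
      rw [this]
      exact .pow_self _ _ 2
  · intro s t hs ht2 ht
    have e2 : Odd (s + t) := hs.add_even (even_iff_two_dvd.2 ht2)
    refine padicValInt_two_lt_mul (mul_ne_zero ht (mul_ne_zero (by decide)
      (pow_ne_zero _ e2.ne_zero_int))) (Dvd.dvd.mul_right ?_ _)
    decide

/-- Duplication on quadratic twists of `y ^ 2 = x * (x - a) * (x - b)` yields infinitely many
points at which the four branch forms are squares away from a fixed integer. -/
theorem exists_square_quadruples {a b : ℤ} (ha : a ≠ 0) (hb : b ≠ 0) (hab : a ≠ b) :
    ∃ N : ℤ, N ≠ 0 ∧ ∃ s t : ℕ → ℤ,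
      (∀ k, s k ≠ 0 ∧ t k ≠ 0 ∧ s k - a * t k ≠ 0 ∧ s k - b * t k ≠ 0 ∧
        CoprimeOff N (s k) (t k) ∧ IsPowOff N 2 (s k) ∧ IsPowOff N 2 (t k) ∧
        IsPowOff N 2 (s k - a * t k) ∧ IsPowOff N 2 (s k - b * t k)) ∧
      ∀ j k, s j * t k = s k * t j → j = k := by
  obtain ⟨N, hN⟩ : ∃ N : ℤ, N = 2 * (a * (b * ((a - b) * ((1 - a * 2) * (1 - b * 2))))) :=
    ⟨_, rfl⟩
  have h2N : (2 : ℤ) ∣ N := ⟨_, hN⟩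
  have haN : a ∣ N := ⟨2 * (b * ((a - b) * ((1 - a * 2) * (1 - b * 2)))), by rw [hN]; ring⟩
  have hbN : b ∣ N := ⟨2 * (a * ((a - b) * ((1 - a * 2) * (1 - b * 2)))), by rw [hN]; ring⟩
  have habN : a - b ∣ N := ⟨2 * (a * (b * ((1 - a * 2) * (1 - b * 2)))), by rw [hN]; ring⟩
  have h1N : 1 - a * 2 ∣ N := ⟨2 * (a * (b * ((a - b) * (1 - b * 2)))), by rw [hN]; ring⟩
  have h1N' : 1 - b * 2 ∣ N := ⟨2 * (a * (b * ((a - b) * (1 - a * 2)))), by rw [hN]; ring⟩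
  have hN0 : N ≠ 0 := by
    have : a - b ≠ 0 := sub_ne_zero.2 hab
    have : 1 - a * 2 ≠ 0 := by omega
    have : 1 - b * 2 ≠ 0 := by omega
    rw [hN]
    positivity
  clear hN
  have hodd : ∀ c s t : ℤ, Odd s → 2 ∣ t → Odd (s - c * t) := fun c s t hs ht =>
    hs.sub_even ((even_iff_two_dvd.2 ht).mul_left c)
  suffices H : ∃ s t : ℕ → ℤ, (∀ k, Odd (s k) ∧ 2 ∣ t k ∧ t k ≠ 0 ∧ CoprimeOff N (s k) (t k) ∧
      IsPowOff N 2 (s k) ∧ IsPowOff N 2 (t k) ∧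
      IsPowOff N 2 (s k - a * t k) ∧ IsPowOff N 2 (s k - b * t k)) ∧
      ∀ j k, s j * t k = s k * t j → j = k by
    obtain ⟨s, t, h, hinj⟩ := H
    refine ⟨N, hN0, s, t, fun k => ?_, hinj⟩
    obtain ⟨hs, ht2, ht, hc, h1, h2, h3, h4⟩ := h k
    exact ⟨hs.ne_zero_int, ht, (hodd _ _ _ hs ht2).ne_zero_int, (hodd _ _ _ hs ht2).ne_zero_int,
      hc, h1, h2, h3, h4⟩
  refine exists_orbit
    (fun s t => Odd s ∧ 2 ∣ t ∧ t ≠ 0 ∧ CoprimeOff N s t ∧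
      IsPowOff N 2 s ∧ IsPowOff N 2 t ∧ IsPowOff N 2 (s - a * t) ∧ IsPowOff N 2 (s - b * t))
    (fun s t => (s ^ 2 - a * b * t ^ 2) ^ 2)
    (fun s t => t * (2 ^ 2 * (s * ((s - a * t) * (s - b * t)))))
    (s₀ := 1) (t₀ := 2)
    ⟨by decide, by decide, by decide, fun p hp h1 _ => (h1.trans (one_dvd _)),
      .of_dvd (one_dvd _), .of_dvd h2N, .of_dvd h1N, .of_dvd h1N'⟩
    (fun s t h => h.1) (fun s t h => h.2.2.1) ?_ ?_
  · rintro s t ⟨hs, ht2, ht, hc, h1, h2, h3, h4⟩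
    have e0 := hs.ne_zero_int
    have e1 := (hodd a s t hs ht2).ne_zero_int
    have e2 := (hodd b s t hs ht2).ne_zero_int
    have e3 : (s - a * t) * (s - b * t) ≠ 0 := mul_ne_zero e1 e2
    have e4 : s * ((s - a * t) * (s - b * t)) ≠ 0 := mul_ne_zero e0 e3
    have e5 : (2 : ℤ) ^ 2 * (s * ((s - a * t) * (s - b * t))) ≠ 0 := mul_ne_zero (by decide) e4
    have e6 : Odd (s ^ 2 - a * b * t ^ 2) := hodd (a * b) _ _ hs.pow (ht2.pow two_ne_zero)
    refine ⟨e6.pow, ht2.mul_right _, mul_ne_zero ht e5,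
      coprimeOff_of_prime fun p hp hpa hpb => ?_, .pow_self _ _ 2,
      ?_, ?_, ?_⟩
    · have hpa' := hp.dvd_of_dvd_pow hpa
      have key : (p : ℤ) ∣ t → (p : ℤ) ∣ N := fun hpt => by
        refine hc.dvd hp (hp.dvd_of_dvd_pow (n := 2) ?_) hpt
        exact (_root_.dvd_sub_left ((hpt.pow two_ne_zero).mul_left _)).1 hpa'
      have key' : ∀ u v : ℤ, (p : ℤ) ∣ u * v * t ^ 2 → u ∣ N → v ∣ N → (p : ℤ) ∣ N :=
        fun u v h hu hv => by
          rcases hp.dvd_or_dvd h with h | h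
          · rcases hp.dvd_or_dvd h with h | h
            · exact h.trans hu
            · exact h.trans hv
          · exact key (hp.dvd_of_dvd_pow h)
      rcases hp.dvd_or_dvd hpb with hpb | hpb
      · exact key hpb
      rcases hp.dvd_or_dvd hpb with hpb | hpb
      · exact (hp.dvd_of_dvd_pow hpb).trans h2N
      rcases hp.dvd_or_dvd hpb with hpb | hpb
      · exact key' a b ((_root_.dvd_sub_right (hpb.pow two_ne_zero)).1 hpa') haN hbN
      rcases hp.dvd_or_dvd hpb with hpb | hpb
      · refine key' a (a - b) ?_ haN habN
        have := hpa'.sub (hpb.mul_right (s + a * t))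
        ring_nf at this ⊢
        exact this
      · refine key' b (a - b) ?_ hbN habN
        have := (hpb.mul_right (s + b * t)).sub hpa'
        ring_nf at this ⊢
        exact this
    · exact h2.mul ht e5 ((IsPowOff.pow_self _ _ 2).mul (by decide) e4
        (h1.mul e0 e3 (h3.mul e1 e2 h4)))
    · have : (s ^ 2 - a * b * t ^ 2) ^ 2 - a * (t * (2 ^ 2 * (s * ((s - a * t) * (s - b * t))))) =
          (s ^ 2 - 2 * a * s * t + a * b * t ^ 2) ^ 2 := by ring
      rw [this]
      exact .pow_self _ _ 2
    · have : (s ^ 2 - a * b * t ^ 2) ^ 2 - b * (t * (2 ^ 2 * (s * ((s - a * t) * (s - b * t))))) =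
          (s ^ 2 - 2 * b * s * t + a * b * t ^ 2) ^ 2 := by ring
      rw [this]
      exact .pow_self _ _ 2
  · rintro s t ⟨hs, ht2, ht, -⟩
    have e1 := (hodd a s t hs ht2).ne_zero_int
    have e2 := (hodd b s t hs ht2).ne_zero_int
    refine padicValInt_two_lt_mul (mul_ne_zero ht (mul_ne_zero (by decide)
      (mul_ne_zero hs.ne_zero_int (mul_ne_zero e1 e2)))) (Dvd.dvd.mul_right ?_ _)
    decide

/-! ### Failure of the Northcott property -/

theorem dvd_ell {α β x y p : ℤ} (hx : p ∣ x) (hy : p ∣ y) : p ∣ ell α β x y :=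
  (hy.mul_left _).sub (hx.mul_left _)

theorem IsPowOff.mul_of_dvd {N N' D a : ℤ} {M : ℕ} (hN' : N' ≠ 0) (hN : N ∣ N') (hD : D ∣ N')
    (ha : a ≠ 0) (h : IsPowOff N M a) : IsPowOff N' M (D * a) :=
  (IsPowOff.of_dvd hD).mul (ne_zero_of_dvd_ne_zero hN' hD) ha (h.mono hN)

theorem not_hasNorthcott_one {α β : Fin 1 → ℤ} {m : Fin 1 → ℕ}
    (hprim : ∀ i, IsCoprime (α i) (β i)) (hm : ∀ i, 0 < m i) :
    ¬ HasNorthcott α β (canonicalHeight α β m) := by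
  obtain ⟨u, v, huv⟩ := hprim 0
  have hell : ∀ k : ℕ, ell (α 0) (β 0) (α 0 * k - v) (β 0 * k + u) = 1 := fun k => by
    rw [ell]
    linear_combination huv
  refine not_hasNorthcott_of_family (M := 0) (N := 1) (x := fun k => α 0 * k - v)
    (y := fun k => β 0 * k + u) hm (by norm_num) one_ne_zero
    (fun k p _ hx hy => hell k ▸ dvd_ell hx hy) (fun k i => ?_) (fun _ _ => Or.inl rfl)
    one_pos fun j k h => ?_
  · rw [Subsingleton.elim i 0, hell]
    exact one_ne_zero
  · have : (j : ℤ) - k = 0 := by linear_combination h - (j - k) * huv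
    omega

theorem not_hasNorthcott_two {α β : Fin 2 → ℤ} {m : Fin 2 → ℕ}
    (hdist : ∀ i j, i ≠ j → α i * β j ≠ α j * β i) (hm : ∀ i, 0 < m i) :
    ¬ HasNorthcott α β (canonicalHeight α β m) := by
  have hD : α 0 * β 1 - α 1 * β 0 ≠ 0 := sub_ne_zero.2 (hdist 0 1 (by decide))
  have hell₀ : ∀ k : ℕ, ell (α 0) (β 0) (α 1 * (k + 1) - α 0) (β 1 * (k + 1) - β 0) =
      (α 0 * β 1 - α 1 * β 0) * (k + 1) := fun k => by rw [ell]; ring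
  have hell₁ : ∀ k : ℕ, ell (α 1) (β 1) (α 1 * (k + 1) - α 0) (β 1 * (k + 1) - β 0) =
      α 0 * β 1 - α 1 * β 0 := fun k => by rw [ell]; ring
  refine not_hasNorthcott_of_family (M := 0) (x := fun k => α 1 * (k + 1) - α 0)
    (y := fun k => β 1 * (k + 1) - β 0) hm (by norm_num) hD
    (fun k p _ hx hy => hell₁ k ▸ dvd_ell hx hy) (fun k => Fin.forall_fin_two.2 ⟨?_, ?_⟩)
    (fun _ _ => Or.inl rfl) two_pos fun j k h => ?_
  · rw [hell₀]
    exact mul_ne_zero hD (by positivity)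
  · rwa [hell₁]
  · have : (α 0 * β 1 - α 1 * β 0) * ((j : ℤ) - k) = 0 := by linear_combination h
    have := (mul_eq_zero.1 this).resolve_left hD
    omega

theorem not_hasNorthcott_three {α β : Fin 3 → ℤ} {m : Fin 3 → ℕ}
    (hdist : ∀ i j, i ≠ j → α i * β j ≠ α j * β i) (hm : ∀ i, 0 < m i)
    {a b c : ℕ} (h : HasTriples a b c) (σ : Equiv.Perm (Fin 3))
    (ha : m (σ 0) ≤ a) (hb : m (σ 1) ≤ b) (hc : c = 0 ∨ m (σ 2) ≤ c)
    (habc : 1 ≤ (a : ℝ)⁻¹ + (b : ℝ)⁻¹ + (c : ℝ)⁻¹) :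
    ¬ HasNorthcott α β (canonicalHeight α β m) := by
  obtain ⟨N, hN, s, t, hst, hinj⟩ := h
  have hD : ∀ i j, i ≠ j → α (σ i) * β (σ j) - α (σ j) * β (σ i) ≠ 0 := fun i j hij =>
    sub_ne_zero.2 (hdist _ _ (σ.injective.ne hij))
  have h01 := hD 0 1 (by decide)
  have h12 := hD 1 2 (by decide)
  have h20 := hD 2 0 (by decide)
  obtain ⟨D01, e01⟩ : ∃ D, D = α (σ 0) * β (σ 1) - α (σ 1) * β (σ 0) := ⟨_, rfl⟩
  obtain ⟨D12, e12⟩ : ∃ D, D = α (σ 1) * β (σ 2) - α (σ 2) * β (σ 1) := ⟨_, rfl⟩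
  obtain ⟨D20, e20⟩ : ∃ D, D = α (σ 2) * β (σ 0) - α (σ 0) * β (σ 2) := ⟨_, rfl⟩
  rw [← e01] at h01
  rw [← e12] at h12
  rw [← e20] at h20
  let x : ℕ → ℤ := fun k => α (σ 1) * D20 * s k - α (σ 0) * D12 * t k
  let y : ℕ → ℤ := fun k => β (σ 1) * D20 * s k - β (σ 0) * D12 * t k
  have l0 : ∀ k, ell (α (σ 0)) (β (σ 0)) (x k) (y k) = D20 * D01 * s k := fun k => by
    simp only [ell, x, y, e01]
    ring
  have l1 : ∀ k, ell (α (σ 1)) (β (σ 1)) (x k) (y k) = D12 * D01 * t k := fun k => by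
    simp only [ell, x, y, e01]
    ring
  have l2 : ∀ k, ell (α (σ 2)) (β (σ 2)) (x k) (y k) = -(D12 * D20) * (s k + t k) := fun k => by
    simp only [ell, x, y, e12, e20]
    ring
  have hN' : N * (D01 * D12 * D20) ≠ 0 := by positivity
  have d0 : D20 * D01 ∣ N * (D01 * D12 * D20) := ⟨N * D12, by ring⟩
  have d1 : D12 * D01 ∣ N * (D01 * D12 * D20) := ⟨N * D20, by ring⟩
  have d2 : -(D12 * D20) ∣ N * (D01 * D12 * D20) := ⟨-(N * D01), by ring⟩
  have dN : N ∣ N * (D01 * D12 * D20) := dvd_mul_right _ _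
  refine not_hasNorthcott_of_family (M := ![a, b, c] ∘ σ.symm) (x := x) (y := y) hm ?_ hN'
    (fun k => coprimeOff_of_prime fun p hp hx hy => ?_)
    (fun k => σ.surjective.forall.2 ?_) (fun k => σ.surjective.forall.2 ?_)
    three_pos fun j k hjk => hinj j k ?_
  · rw [← Equiv.sum_comp σ]
    simp only [Function.comp_apply, Equiv.symm_apply_apply, Fin.sum_univ_three]
    norm_num
    exact habc
  · have p0 : (p : ℤ) ∣ D20 * D01 * s k := l0 k ▸ dvd_ell hx hy
    have p1 : (p : ℤ) ∣ D12 * D01 * t k := l1 k ▸ dvd_ell hx hy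
    rcases hp.dvd_or_dvd p0 with p0 | p0
    · exact p0.trans d0
    rcases hp.dvd_or_dvd p1 with p1 | p1
    · exact p1.trans d1
    exact ((hst k).2.2.2.1.dvd hp p0 p1).trans dN
  · obtain ⟨hs, ht, hs't, -⟩ := hst k
    rw [Fin.forall_fin_succ, Fin.forall_fin_two]
    refine ⟨?_, ?_, ?_⟩
    · rw [l0]
      positivity
    · exact (l1 k).trans_ne (mul_ne_zero (by positivity) ht)
    · exact (l2 k).trans_ne (mul_ne_zero (neg_ne_zero.2 (by positivity)) hs't)
  · obtain ⟨hs, ht, hs't, -, qa, qb, qc⟩ := hst k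
    simp only [Function.comp_apply, Equiv.symm_apply_apply]
    rw [Fin.forall_fin_succ, Fin.forall_fin_two]
    refine ⟨Or.inr ⟨ha, ?_⟩, Or.inr ⟨hb, ?_⟩, ?_⟩
    · exact l0 k ▸ qa.mul_of_dvd hN' dN d0 hs
    · exact (l1 k).symm ▸ qb.mul_of_dvd hN' dN d1 ht
    · rcases hc with hc | hc
      · exact Or.inl hc
      rcases qc with qc | qc
      · exact Or.inl qc
      · exact Or.inr ⟨hc, (l2 k).symm ▸ qc.mul_of_dvd hN' dN d2 hs't⟩
  · have key : D01 * D12 * D20 * (s j * t k - s k * t j) = 0 := by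
      simp only [x, y] at hjk
      rw [e01]
      linear_combination hjk
    exact sub_eq_zero.1 ((mul_eq_zero.1 key).resolve_left (by positivity))

theorem not_hasNorthcott_four {α β : Fin 4 → ℤ} {m : Fin 4 → ℕ}
    (hdist : ∀ i j, i ≠ j → α i * β j ≠ α j * β i) (hm : ∀ i, 0 < m i)
    (hm2 : ∀ i, m i ≤ 2) :
    ¬ HasNorthcott α β (canonicalHeight α β m) := by
  have hD : ∀ i j, i ≠ j → α i * β j - α j * β i ≠ 0 := fun i j hij =>
    sub_ne_zero.2 (hdist _ _ hij)
  have h01 := hD 0 1 (by decide)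
  have h02 := hD 0 2 (by decide)
  have h03 := hD 0 3 (by decide)
  have h12 := hD 1 2 (by decide)
  have h13 := hD 1 3 (by decide)
  have h23 := hD 2 3 (by decide)
  obtain ⟨D01, e01⟩ : ∃ D, D = α 0 * β 1 - α 1 * β 0 := ⟨_, rfl⟩
  obtain ⟨D02, e02⟩ : ∃ D, D = α 0 * β 2 - α 2 * β 0 := ⟨_, rfl⟩
  obtain ⟨D03, e03⟩ : ∃ D, D = α 0 * β 3 - α 3 * β 0 := ⟨_, rfl⟩
  obtain ⟨D12, e12⟩ : ∃ D, D = α 1 * β 2 - α 2 * β 1 := ⟨_, rfl⟩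
  obtain ⟨D13, e13⟩ : ∃ D, D = α 1 * β 3 - α 3 * β 1 := ⟨_, rfl⟩
  obtain ⟨D23, e23⟩ : ∃ D, D = α 2 * β 3 - α 3 * β 2 := ⟨_, rfl⟩
  rw [← e01] at h01
  rw [← e02] at h02
  rw [← e03] at h03
  rw [← e12] at h12
  rw [← e13] at h13
  rw [← e23] at h23
  have hab : D01 * D23 ≠ D02 * D13 := by
    intro h
    have : D03 * D12 = 0 := by
      rw [e03, e12]
      rw [e01, e23, e02, e13] at h
      linear_combination -h
    exact mul_ne_zero h03 h12 this
  obtain ⟨N, hN, s, t, hst, hinj⟩ :=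
    exists_square_quadruples (mul_ne_zero h01 h23) (mul_ne_zero h02 h13) hab
  let x : ℕ → ℤ := fun k => α 3 * s k + α 0 * D13 * D23 * t k
  let y : ℕ → ℤ := fun k => β 3 * s k + β 0 * D13 * D23 * t k
  have l0 : ∀ k, ell (α 0) (β 0) (x k) (y k) = D03 * s k := fun k => by
    simp only [ell, x, y, e03]
    ring
  have l1 : ∀ k, ell (α 1) (β 1) (x k) (y k) = D13 * (s k - D01 * D23 * t k) := fun k => by
    simp only [ell, x, y, e01, e13]
    ring
  have l2 : ∀ k, ell (α 2) (β 2) (x k) (y k) = D23 * (s k - D02 * D13 * t k) := fun k => by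
    simp only [ell, x, y, e02, e23]
    ring
  have l3 : ∀ k, ell (α 3) (β 3) (x k) (y k) = -(D03 * D13 * D23) * t k := fun k => by
    simp only [ell, x, y, e03]
    ring
  have hN' : N * (D03 * D13 * D23) ≠ 0 := by positivity
  have d0 : D03 ∣ N * (D03 * D13 * D23) := ⟨N * D13 * D23, by ring⟩
  have d1 : D13 ∣ N * (D03 * D13 * D23) := ⟨N * D03 * D23, by ring⟩
  have d2 : D23 ∣ N * (D03 * D13 * D23) := ⟨N * D03 * D13, by ring⟩
  have d3 : -(D03 * D13 * D23) ∣ N * (D03 * D13 * D23) := ⟨-N, by ring⟩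
  have dN : N ∣ N * (D03 * D13 * D23) := dvd_mul_right _ _
  refine not_hasNorthcott_of_family (M := fun _ => 2) (x := x) (y := y) hm (by norm_num) hN'
    (fun k => coprimeOff_of_prime fun p hp hx hy => ?_)
    (fun k => ?_) (fun k i => Or.inr ⟨hm2 i, ?_⟩)
    four_pos fun j k hjk => hinj j k ?_
  · have p0 : (p : ℤ) ∣ D03 * s k := l0 k ▸ dvd_ell hx hy
    have p3 : (p : ℤ) ∣ -(D03 * D13 * D23) * t k := l3 k ▸ dvd_ell hx hy
    rcases hp.dvd_or_dvd p0 with p0 | p0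
    · exact p0.trans d0
    rcases hp.dvd_or_dvd p3 with p3 | p3
    · exact p3.trans d3
    exact ((hst k).2.2.2.2.1.dvd hp p0 p3).trans dN
  · obtain ⟨hs, ht, ha, hb, -⟩ := hst k
    rw [Fin.forall_fin_succ, Fin.forall_fin_succ, Fin.forall_fin_two]
    exact ⟨(l0 k).trans_ne (mul_ne_zero h03 hs), (l1 k).trans_ne (mul_ne_zero h13 ha),
      (l2 k).trans_ne (mul_ne_zero h23 hb), (l3 k).trans_ne (mul_ne_zero (neg_ne_zero.2 (by positivity)) ht)⟩
  · obtain ⟨hs, ht, ha, hb, -, q0, q3, q1, q2⟩ := hst k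
    revert i
    rw [Fin.forall_fin_succ, Fin.forall_fin_succ, Fin.forall_fin_two]
    exact ⟨(l0 k).symm ▸ q0.mul_of_dvd hN' dN d0 hs, (l1 k).symm ▸ q1.mul_of_dvd hN' dN d1 ha,
      (l2 k).symm ▸ q2.mul_of_dvd hN' dN d2 hb, (l3 k).symm ▸ q3.mul_of_dvd hN' dN d3 ht⟩
  · have key : D03 * D13 * D23 * (s j * t k - s k * t j) = 0 := by
      simp only [x, y] at hjk
      rw [e03]
      linear_combination -hjk
    exact sub_eq_zero.1 ((mul_eq_zero.1 key).resolve_left (by positivity))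

theorem classify_triples {a b c : ℕ} (ha : 2 ≤ a) (hab : a ≤ b) (hbc : b ≤ c)
    (h : a * b * c ≤ b * c + a * c + a * b) :
    (a = 2 ∧ b = 2) ∨ (a = 2 ∧ b = 3 ∧ c ≤ 6) ∨ (a = 2 ∧ b = 4 ∧ c = 4) ∨
      (a = 3 ∧ b = 3 ∧ c = 3) := by
  have ha3 : a ≤ 3 := by
    have h1 : a * c ≤ b * c := Nat.mul_le_mul_right c hab
    have h2 : a * b ≤ b * c := by
      rw [mul_comm b c]
      exact Nat.mul_le_mul_right b (hab.trans hbc)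
    have h3 : a * (b * c) ≤ 3 * (b * c) := by linarith
    exact Nat.le_of_mul_le_mul_right h3 (Nat.mul_pos (by omega) (by omega))
  have hb4 : b ≤ 4 := by
    by_contra! hb
    interval_cases a <;> nlinarith
  interval_cases a <;> interval_cases b <;> omega

theorem not_hasNorthcott_of_deltaM_nonneg {n : ℕ} (hn : 1 ≤ n) {α β : Fin n → ℤ}
    (hprim : ∀ i, IsCoprime (α i) (β i))
    (hdist : ∀ i j, i ≠ j → α i * β j ≠ α j * β i)
    {m : Fin n → ℕ} (hm : ∀ i, 2 ≤ m i) (hδ : 0 ≤ deltaM m) :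
    ¬ HasNorthcott α β (canonicalHeight α β m) := by
  have hm0 : ∀ i, 0 < m i := fun i => two_pos.trans_le (hm i)
  have hinv : ∀ i, (m i : ℝ)⁻¹ ≤ 2⁻¹ := fun i => by
    have : (2 : ℝ) ≤ m i := by exact_mod_cast hm i
    gcongr
  have hsum : (n : ℝ) - 2 ≤ ∑ i, (m i : ℝ)⁻¹ := by
    simp only [deltaM, Finset.sum_sub_distrib, Finset.sum_const, Finset.card_univ,
      Fintype.card_fin, nsmul_eq_mul, mul_one] at hδ
    linarith
  have hn4 : n ≤ 4 := by
    have h := hsum.trans (Finset.sum_le_sum fun i _ => hinv i)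
    simp only [Finset.sum_const, Finset.card_univ, Fintype.card_fin, nsmul_eq_mul] at h
    have : (n : ℝ) ≤ 4 := by linarith
    exact_mod_cast this
  interval_cases n
  · exact not_hasNorthcott_one hprim hm0
  · exact not_hasNorthcott_two hdist hm0
  · have hσ := Tuple.monotone_sort m
    obtain ⟨σ, hσ'⟩ : ∃ σ, σ = Tuple.sort m := ⟨_, rfl⟩
    rw [← hσ'] at hσ
    have h01 : m (σ 0) ≤ m (σ 1) := hσ (by decide)
    have h12 : m (σ 1) ≤ m (σ 2) := hσ (by decide)
    rw [← Equiv.sum_comp σ, Fin.sum_univ_three] at hsum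
    have p0 : (0 : ℝ) < m (σ 0) := by exact_mod_cast hm0 _
    have p1 : (0 : ℝ) < m (σ 1) := by exact_mod_cast hm0 _
    have p2 : (0 : ℝ) < m (σ 2) := by exact_mod_cast hm0 _
    have hprod : m (σ 0) * m (σ 1) * m (σ 2) ≤
        m (σ 1) * m (σ 2) + m (σ 0) * m (σ 2) + m (σ 0) * m (σ 1) := by
      have h1 : (1 : ℝ) ≤ (m (σ 0) : ℝ)⁻¹ + (m (σ 1) : ℝ)⁻¹ + (m (σ 2) : ℝ)⁻¹ := by
        norm_num at hsum ⊢
        exact hsum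
      have h2 := mul_le_mul_of_nonneg_left h1 (by positivity :
        (0 : ℝ) ≤ m (σ 0) * m (σ 1) * m (σ 2))
      have h3 : (m (σ 0) * m (σ 1) * m (σ 2) : ℝ) *
          ((m (σ 0) : ℝ)⁻¹ + (m (σ 1) : ℝ)⁻¹ + (m (σ 2) : ℝ)⁻¹) =
          m (σ 1) * m (σ 2) + m (σ 0) * m (σ 2) + m (σ 0) * m (σ 1) := by
        field_simp
      rw [h3, mul_one] at h2
      exact_mod_cast h2
    have r0 : (σ * finRotate 3) 0 = σ 1 := rfl
    have r1 : (σ * finRotate 3) 1 = σ 2 := rfl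
    have r2 : (σ * finRotate 3) 2 = σ 0 := rfl
    rcases classify_triples (hm _) h01 h12 hprod with ⟨h0, h1⟩ | ⟨h0, h1, h2⟩ | ⟨h0, h1, h2⟩ |
      ⟨h0, h1, h2⟩
    · exact not_hasNorthcott_three hdist hm0 hasTriples_two_two_zero σ h0.le h1.le
        (Or.inl rfl) (by norm_num)
    · exact not_hasNorthcott_three hdist hm0 hasTriples_three_six_two (σ * finRotate 3)
        (r0 ▸ h1.le) (r1 ▸ h2) (Or.inr (r2 ▸ h0.le)) (by norm_num)
    · exact not_hasNorthcott_three hdist hm0 hasTriples_four_four_two (σ * finRotate 3)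
        (r0 ▸ h1.le) (r1 ▸ h2.le) (Or.inr (r2 ▸ h0.le)) (by norm_num)
    · exact not_hasNorthcott_three hdist hm0 hasTriples_three_three_three σ h0.le h1.le
        (Or.inr h2.le) (by norm_num)
  · refine not_hasNorthcott_four hdist hm0 fun i => ?_
    have h := Finset.add_sum_erase Finset.univ (fun j => (m j : ℝ)⁻¹) (Finset.mem_univ i)
    have h' := Finset.sum_le_sum fun j (_ : j ∈ Finset.univ.erase i) => hinv j
    rw [Finset.sum_const, Finset.card_erase_of_mem (Finset.mem_univ i), Finset.card_univ,
      Fintype.card_fin] at h'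
    norm_num at h' hsum h
    have hi : (2 : ℝ)⁻¹ ≤ (m i : ℝ)⁻¹ := by linarith
    have hp : (0 : ℝ) < m i := by exact_mod_cast hm0 i
    have := (inv_le_inv₀ two_pos hp).1 hi
    exact_mod_cast this

/-- The canonical height on a stacky curve with coarse space `ℙ¹` has the Northcott
property if and only if `δ(𝐦) < 0`. -/
theorem canonical_height_northcott_iff
    (n : ℕ) (hn : 1 ≤ n) (α β : Fin n → ℤ)
    (hprim : ∀ i, IsCoprime (α i) (β i))
    (hdist : ∀ i j, i ≠ j → α i * β j ≠ α j * β i)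
    (m : Fin n → ℕ) (hm : ∀ i, 2 ≤ m i) :
    HasNorthcott α β (canonicalHeight α β m) ↔ deltaM m < 0 := by
  refine ⟨fun h => ?_, hasNorthcott_of_deltaM_neg α β⟩
  by_contra! hδ
  exact not_hasNorthcott_of_deltaM_nonneg hn hprim hdist hm hδ h
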